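/- arXiv:1710.06332 — 3 statements merged into one kernel-verified Lean document; each statement's English description precedes it below -/
import Mathlib

section
/- Let n ≥ 1, let K ⊂ ℝⁿ be compact, let N ≥ 2 be an integer, and let Φ be a real-valued C^N function on an open neighborhood of K satisfying |∇Φ(x)| ≥ c > 0 for all x ∈ K. Set M := max_{|α| ≤ N} sup_{x∈K} |∂^α Φ(x)|. Then there is a constant C > 0, depending only on n, N, c and M, such that for every σ ∈ ℝ with |σ| ≥ 1 and every complex-valued C^{N−1} function f on ℝⁿ with compact support contained in K, | ∫_{ℝⁿ} f(x) e^{iσΦ(x)} dx | ≤ C |σ|^{1−N} Σ_{|α| ≤ N−1} ∫_{ℝⁿ} |∂^α f(x)| dx. -/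
open MeasureTheory

/-- Iterated partial derivative of `f` along the list of coordinate directions `L`. -/
noncomputable def pderivList {n : ℕ} {E : Type*} [NormedAddCommGroup E] [NormedSpace ℝ E]
    (L : List (Fin n)) (f : EuclideanSpace ℝ (Fin n) → E) : EuclideanSpace ℝ (Fin n) → E :=
  L.foldr (fun i g => fun x => fderiv ℝ g x (EuclideanSpace.single i 1)) f

/-- The partial derivative `∂^α f` for a multi-index `α : Fin n → ℕ`. -/
noncomputable def mderiv {n : ℕ} {E : Type*} [NormedAddCommGroup E] [NormedSpace ℝ E]
    (α : Fin n → ℕ) (f : EuclideanSpace ℝ (Fin n) → E) : EuclideanSpace ℝ (Fin n) → E :=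
  pderivList ((List.finRange n).flatMap fun i => List.replicate (α i) i) f

open scoped ContDiff

lemma pderivList_contDiffOn {n : ℕ} {F : Type*} [NormedAddCommGroup F] [NormedSpace ℝ F]
    {U : Set (EuclideanSpace ℝ (Fin n))} (hU : IsOpen U) {h : EuclideanSpace ℝ (Fin n) → F} {k : ℕ}
    (hh : ContDiffOn ℝ k h U) (L : List (Fin n)) :
    ∀ m : ℕ, m + L.length ≤ k → ContDiffOn ℝ m (pderivList L h) U := by
  induction L with
  | nil => intro m hm; exact hh.of_le (by exact_mod_cast hm)
  | cons i L ih =>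
    intro m hm
    have h1 := ih (m + 1) (by simp at hm; omega)
    have h2 : ContDiffOn ℝ m (fderiv ℝ (pderivList L h)) U :=
      h1.fderiv_of_isOpen hU (by norm_cast)
    exact h2.clm_apply contDiffOn_const

lemma pderivList_perm {n : ℕ} {F : Type*} [NormedAddCommGroup F] [NormedSpace ℝ F]
    {U : Set (EuclideanSpace ℝ (Fin n))} (hU : IsOpen U) {h : EuclideanSpace ℝ (Fin n) → F} {k : ℕ}
    (hh : ContDiffOn ℝ k h U) {L L' : List (Fin n)} (hp : L.Perm L') :
    L.length ≤ k → ∀ x ∈ U, pderivList L h x = pderivList L' h x := by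
  induction hp with
  | nil => intros; rfl
  | cons i hp ih =>
    rename_i L L'
    intro hk x hx
    have h1 : pderivList L h =ᶠ[nhds x] pderivList L' h := by
      filter_upwards [hU.mem_nhds hx] with y hy
      exact ih (by simp at hk; omega) y hy
    change fderiv ℝ (pderivList L h) x _ = fderiv ℝ (pderivList L' h) x _
    rw [h1.fderiv_eq]
  | swap i j L =>
    intro hk x hx
    have h1 : ContDiffOn ℝ (2 : ℕ) (pderivList L h) U :=
      pderivList_contDiffOn hU hh L 2 (by simp at hk; omega)
    have h2 : ContDiffAt ℝ 2 (pderivList L h) x := h1.contDiffAt (hU.mem_nhds hx)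
    have h3 : DifferentiableAt ℝ (fderiv ℝ (pderivList L h)) x :=
      (h2.fderiv_right (m := 1) (by norm_num)).differentiableAt (by norm_num)
    have h4 := h2.isSymmSndFDerivAt (by simp)
    change fderiv ℝ (fun y => fderiv ℝ (pderivList L h) y _) x _ =
      fderiv ℝ (fun y => fderiv ℝ (pderivList L h) y _) x _
    rw [fderiv_clm_apply h3 (by fun_prop), fderiv_clm_apply h3 (by fun_prop)]
    simp
    exact h4 _ _
  | trans p q ih1 ih2 =>
    intro hk x hx
    rw [ih1 hk x hx, ih2 (by rw [← p.length_eq]; exact hk) x hx]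

lemma pderivList_eq_iteratedFDeriv {n : ℕ} {F : Type*} [NormedAddCommGroup F] [NormedSpace ℝ F]
    {U : Set (EuclideanSpace ℝ (Fin n))} (hU : IsOpen U) {h : EuclideanSpace ℝ (Fin n) → F} {k : ℕ}
    (hh : ContDiffOn ℝ k h U) (L : List (Fin n)) :
    L.length ≤ k → ∀ x ∈ U, pderivList L h x =
      iteratedFDeriv ℝ L.length h x (fun i => EuclideanSpace.single (L.get i) 1) := by
  induction L with
  | nil => intro _ x _; simp [pderivList]
  | cons i L ih =>
    intro hk x hx
    have h1 : pderivList L h =ᶠ[nhds x] fun y =>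
        iteratedFDeriv ℝ L.length h y (fun i => EuclideanSpace.single (L.get i) 1) := by
      filter_upwards [hU.mem_nhds hx] with y hy
      exact ih (by simp at hk; omega) y hy
    change fderiv ℝ (pderivList L h) x _ = _
    have h2 : DifferentiableAt ℝ (iteratedFDeriv ℝ L.length h) x := by
      have := (hh.contDiffAt (hU.mem_nhds hx)).iteratedFDeriv_right (m := 1) (i := L.length)
        (by simp at hk; norm_cast; omega)
      exact this.differentiableAt (by norm_num)
    rw [h1.fderiv_eq, fderiv_continuousMultilinear_apply_const_apply h2]
    rfl

lemma norm_multilinear_le {n k : ℕ} {F : Type*} [NormedAddCommGroup F] [NormedSpace ℝ F]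
    (T : ContinuousMultilinearMap ℝ (fun _ : Fin k => EuclideanSpace ℝ (Fin n)) F) :
    ‖T‖ ≤ ∑ r : Fin k → Fin n, ‖T (fun i => EuclideanSpace.single (r i) 1)‖ := by
  refine ContinuousMultilinearMap.opNorm_le_bound (by positivity) fun m => ?_
  have h1 : m = fun i => ∑ j, (m i j) • (EuclideanSpace.single j (1:ℝ)) := by
    funext i
    ext l
    simp [Finset.sum_apply, Pi.single_apply]
  conv_lhs => rw [h1]
  rw [ContinuousMultilinearMap.map_sum, Finset.sum_mul]
  refine (norm_sum_le _ _).trans (Finset.sum_le_sum fun r _ => ?_)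
  rw [ContinuousMultilinearMap.map_smul_univ, norm_smul, mul_comm, norm_prod]
  gcongr with i
  exact PiLp.norm_apply_le (m i) (r i)

lemma sort_perm {n : ℕ} (L : List (Fin n)) :
    L.Perm ((List.finRange n).flatMap fun i => List.replicate (L.count i) i) := by
  rw [List.perm_iff_count]
  intro a
  rw [List.count_flatMap]
  have : (List.count a ∘ fun i => List.replicate (List.count i L) i) =
      fun i => if i = a then L.count a else 0 := by
    funext i
    by_cases h : i = a
    · subst h; simp
    · simp [List.count_replicate, h]
  rw [this, ← List.ofFn_eq_map, List.sum_ofFn]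
  simp

lemma sum_count {n : ℕ} (L : List (Fin n)) : ∑ i, L.count i = L.length := by
  have := (sort_perm L).length_eq
  rw [List.length_flatMap, ← List.ofFn_eq_map, List.sum_ofFn] at this
  simpa using this.symm

lemma norm_iteratedFDeriv_le_mderiv {n : ℕ} {F : Type*} [NormedAddCommGroup F] [NormedSpace ℝ F]
    {U : Set (EuclideanSpace ℝ (Fin n))} (hU : IsOpen U) {h : EuclideanSpace ℝ (Fin n) → F} {k : ℕ}
    (hh : ContDiffOn ℝ k h U) {m : ℕ} (hm : m ≤ k) {x : EuclideanSpace ℝ (Fin n)} (hx : x ∈ U) (B : ℝ)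
    (hB : ∀ α : Fin n → ℕ, ∑ i, α i = m → ‖mderiv α h x‖ ≤ B) :
    ‖iteratedFDeriv ℝ m h x‖ ≤ n ^ m * B := by
  refine (norm_multilinear_le _).trans ?_
  have : ∀ r : Fin m → Fin n,
      ‖iteratedFDeriv ℝ m h x (fun i => EuclideanSpace.single (r i) 1)‖ ≤ B := by
    intro r
    obtain ⟨L, hL, hr⟩ : ∃ L : List (Fin n), ∃ hL : L.length = m, ∀ i, r i = L.get (i.cast hL.symm) :=
      ⟨List.ofFn r, by simp, by simp⟩
    subst hL
    have h1 := pderivList_eq_iteratedFDeriv hU hh L hm x hx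
    have h2 : r = L.get := by funext i; simpa using hr i
    rw [h2, ← h1, pderivList_perm hU hh (sort_perm L) hm x hx]
    exact hB _ (sum_count L)
  refine (Finset.sum_le_sum fun r _ => this r).trans ?_
  simp

lemma contDiff_smul_of_tsupport {E F : Type*} [NormedAddCommGroup E] [NormedSpace ℝ E]
    [NormedAddCommGroup F] [NormedSpace ℝ F] {U : Set E} (hU : IsOpen U) {p : ℕ} {a : E → ℝ} {g : E → F}
    (ha : ContDiffOn ℝ p a U) (hg : ContDiff ℝ p g) (hs : tsupport g ⊆ U) :
    ContDiff ℝ p (fun y => a y • g y) := by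
  rw [contDiff_iff_contDiffAt]
  intro x
  by_cases hx : x ∈ tsupport g
  · exact (ha.contDiffAt (hU.mem_nhds (hs hx))).smul hg.contDiffAt
  · have : (fun y => a y • g y) =ᶠ[nhds x] fun _ => 0 := by
      filter_upwards [(isClosed_tsupport g).isOpen_compl.mem_nhds hx] with y hy
      rw [image_eq_zero_of_notMem_tsupport hy, smul_zero]
    exact contDiffAt_const.congr_of_eventuallyEq this

/-- The transposed non-stationary phase operator `g ↦ ∑ ∂ⱼ (aⱼ g)`. -/
noncomputable def phaseOp {n : ℕ} (a : Fin n → EuclideanSpace ℝ (Fin n) → ℝ)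
    (g : EuclideanSpace ℝ (Fin n) → ℂ) : EuclideanSpace ℝ (Fin n) → ℂ :=
  fun x => ∑ j, fderiv ℝ (fun y => a j y • g y) x (EuclideanSpace.single j 1)

lemma tsupport_phaseOp {n : ℕ} (a : Fin n → EuclideanSpace ℝ (Fin n) → ℝ)
    (g : EuclideanSpace ℝ (Fin n) → ℂ) : tsupport (phaseOp a g) ⊆ tsupport g := by
  refine closure_minimal ?_ (isClosed_tsupport g)
  intro x hx
  by_contra hxg
  apply hx
  refine Finset.sum_eq_zero fun j _ => ?_
  have : x ∉ tsupport (fderiv ℝ (fun y => a j y • g y)) := fun h =>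
    hxg (tsupport_smul_subset_right (a j) g (tsupport_fderiv_subset ℝ h))
  rw [image_eq_zero_of_notMem_tsupport this]
  rfl

lemma contDiff_phaseOp {n : ℕ} {U : Set (EuclideanSpace ℝ (Fin n))} (hU : IsOpen U) {p : ℕ}
    {a : Fin n → EuclideanSpace ℝ (Fin n) → ℝ} {g : EuclideanSpace ℝ (Fin n) → ℂ}
    (ha : ∀ j, ContDiffOn ℝ (p + 1 : ℕ) (a j) U) (hg : ContDiff ℝ (p + 1 : ℕ) g)
    (hs : tsupport g ⊆ U) : ContDiff ℝ p (phaseOp a g) := by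
  refine ContDiff.sum fun j _ => ?_
  have := contDiff_smul_of_tsupport hU (ha j) hg hs
  exact (this.fderiv_right (m := p) (by norm_cast)).clm_apply contDiff_const

lemma norm_phaseOp_le {n : ℕ} {U : Set (EuclideanSpace ℝ (Fin n))} (hU : IsOpen U) {p : ℕ}
    {a : Fin n → EuclideanSpace ℝ (Fin n) → ℝ} {g : EuclideanSpace ℝ (Fin n) → ℂ}
    (ha : ∀ j, ContDiffOn ℝ (p + 1 : ℕ) (a j) U) (hg : ContDiff ℝ (p + 1 : ℕ) g)
    (hs : tsupport g ⊆ U) {A : ℝ} (hA : 0 ≤ A) {x : EuclideanSpace ℝ (Fin n)} (hx : x ∈ U)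
    (hb : ∀ j, ∀ i ≤ p + 1, ‖iteratedFDeriv ℝ i (a j) x‖ ≤ A) :
    ∑ m ∈ Finset.range (p + 1), ‖iteratedFDeriv ℝ m (phaseOp a g) x‖ ≤
      ((p + 1) * (n * (2 ^ (p + 1) * A))) * ∑ i ∈ Finset.range (p + 2), ‖iteratedFDeriv ℝ i g x‖ := by
  set S := ∑ i ∈ Finset.range (p + 2), ‖iteratedFDeriv ℝ i g x‖ with hS
  have hS0 : 0 ≤ S := Finset.sum_nonneg fun _ _ => norm_nonneg _
  have key : ∀ m ∈ Finset.range (p + 1), ‖iteratedFDeriv ℝ m (phaseOp a g) x‖ ≤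
      n * (2 ^ (p + 1) * A * S) := by
    intro m hm
    rw [Finset.mem_range] at hm
    have hC := fun j => contDiff_smul_of_tsupport hU (ha j) hg hs
    have hD := fun j => (hC j).fderiv_right (m := p) (by norm_cast)
    have h1 : iteratedFDeriv ℝ m (phaseOp a g) x = ∑ j, iteratedFDeriv ℝ m
        (fun y => fderiv ℝ (fun y => a j y • g y) y (EuclideanSpace.single j 1)) x := by
      have h0 : phaseOp a g = ∑ j, (fun y => fderiv ℝ (fun y => a j y • g y) y
        (EuclideanSpace.single j 1)) := by
        funext y; simp [phaseOp]
      rw [h0]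
      refine iteratedFDeriv_sum_apply fun j _ => ?_
      exact (((hD j).clm_apply contDiff_const).of_le (by norm_cast; omega)).contDiffAt
    rw [h1]
    refine (norm_sum_le _ _).trans ?_
    have h2 : ∀ j ∈ Finset.univ, ‖iteratedFDeriv ℝ m
        (fun y => fderiv ℝ (fun y => a j y • g y) y (EuclideanSpace.single j 1)) x‖ ≤
        2 ^ (p + 1) * A * S := by
      intro j _
      refine (norm_iteratedFDeriv_clm_apply_const (N := p) (hD j).contDiffAt
        (by norm_cast; omega)).trans ?_
      rw [norm_iteratedFDeriv_fderiv]
      simp only [PiLp.norm_single, norm_one, one_mul]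
      rw [← iteratedFDerivWithin_of_isOpen _ hU hx]
      refine (norm_iteratedFDerivWithin_smul_le (ha j) hg.contDiffOn hU.uniqueDiffOn hx
        (n := m + 1) (by norm_cast)).trans ?_
      have h3 : ∀ i ∈ Finset.range (m + 1 + 1), ((m + 1).choose i : ℝ) *
          ‖iteratedFDerivWithin ℝ i (a j) U x‖ * ‖iteratedFDerivWithin ℝ (m + 1 - i) g U x‖ ≤
          ((m + 1).choose i : ℝ) * (A * S) := by
        intro i hi
        rw [Finset.mem_range] at hi
        rw [mul_assoc, iteratedFDerivWithin_of_isOpen _ hU hx, iteratedFDerivWithin_of_isOpen _ hU hx]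
        gcongr
        · exact hb j i (by omega)
        · exact Finset.single_le_sum (f := fun i => ‖iteratedFDeriv ℝ i g x‖)
            (fun _ _ => norm_nonneg _) (Finset.mem_range.2 (by omega))
      refine (Finset.sum_le_sum h3).trans ?_
      rw [← Finset.sum_mul, mul_assoc]
      gcongr
      have := Nat.sum_range_choose (m + 1)
      have h4 : (∑ i ∈ Finset.range (m + 1 + 1), ((m + 1).choose i : ℝ)) = 2 ^ (m + 1) := by
        exact_mod_cast this
      rw [h4]
      have hmp : m + 1 ≤ p + 1 := hm
      exact pow_le_pow_right₀ (by norm_num) hmp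
    refine (Finset.sum_le_sum h2).trans ?_
    simp
  refine (Finset.sum_le_sum key).trans ?_
  simp
  apply le_of_eq
  ring

lemma phase_ibp {n : ℕ} {K U : Set (EuclideanSpace ℝ (Fin n))} (hK : IsCompact K) (hU : IsOpen U)
    (hKU : K ⊆ U) {a : Fin n → EuclideanSpace ℝ (Fin n) → ℝ} {g : EuclideanSpace ℝ (Fin n) → ℂ}
    {Φ : EuclideanSpace ℝ (Fin n) → ℝ} (hΦ : ContDiffOn ℝ 1 Φ U)
    (ha : ∀ j, ContDiffOn ℝ 1 (a j) U) (hg : ContDiff ℝ 1 g)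
    (hs : tsupport g ⊆ K)
    (haΦ : ∀ x ∈ K, ∑ j, a j x * fderiv ℝ Φ x (EuclideanSpace.single j 1) = 1)
    {σ : ℝ} (hσ : 1 ≤ |σ|) :
    ‖∫ x, g x * Complex.exp (Complex.I * σ * Φ x)‖ ≤
      |σ|⁻¹ * ‖∫ x, phaseOp a g x * Complex.exp (Complex.I * σ * Φ x)‖ := by
  have hgU := hs.trans hKU
  have hcs : HasCompactSupport g := hK.of_isClosed_subset (isClosed_tsupport g) hs
  set e : EuclideanSpace ℝ (Fin n) → ℂ := fun x => Complex.exp (Complex.I * σ * Φ x) with he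
  have heU : ContDiffOn ℝ 1 e U := by
    have : ContDiffOn ℝ 1 (fun x => (Φ x : ℂ)) U := Complex.ofRealCLM.contDiff.comp_contDiffOn hΦ
    exact (contDiffOn_const.mul this).cexp
  have hprod : ∀ {h : EuclideanSpace ℝ (Fin n) → ℂ}, ContDiff ℝ 1 h → tsupport h ⊆ U →
      ContDiff ℝ 1 (fun x => h x * e x) := by
    intro h hh hhs
    rw [contDiff_iff_contDiffAt]
    intro x
    by_cases hx : x ∈ tsupport h
    · exact hh.contDiffAt.mul (heU.contDiffAt (hU.mem_nhds (hhs hx)))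
    · have : (fun y => h y * e y) =ᶠ[nhds x] fun _ => 0 := by
        filter_upwards [(isClosed_tsupport h).isOpen_compl.mem_nhds hx] with y hy
        rw [image_eq_zero_of_notMem_tsupport hy, zero_mul]
      exact contDiffAt_const.congr_of_eventuallyEq this
  have hag : ∀ j, ContDiff ℝ 1 (fun y => a j y • g y) := fun j =>
    contDiff_smul_of_tsupport (p := 1) hU (ha j) hg hgU
  have hags : ∀ j, tsupport (fun y => a j y • g y) ⊆ tsupport g := fun j =>
    tsupport_smul_subset_right (a j) g
  have hagc : ∀ j, HasCompactSupport (fun y => a j y • g y) := fun j =>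
    hcs.of_isClosed_subset (isClosed_tsupport _) (hags j)
  have hH : ∀ j, ContDiff ℝ 1 (fun y => (a j y • g y) * e y) := fun j =>
    hprod (hag j) ((hags j).trans hgU)
  have hHc : ∀ j, HasCompactSupport (fun y => (a j y • g y) * e y) := fun j => (hagc j).mul_right
  have hI : ∀ j, Integrable (fun x => fderiv ℝ (fun y => (a j y • g y) * e y) x
      (EuclideanSpace.single j 1)) := fun j =>
    ((((hH j).continuous_fderiv (by norm_num)).clm_apply continuous_const)).integrable_of_hasCompactSupport
      ((hHc j).fderiv_apply (𝕜 := ℝ) _)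
  have hzero : ∀ j, ∫ x, fderiv ℝ (fun y => (a j y • g y) * e y) x
      (EuclideanSpace.single j 1) = 0 := by
    intro j
    have := integral_mul_fderiv_eq_neg_fderiv_mul_of_integrable (μ := volume)
      (f := fun _ : EuclideanSpace ℝ (Fin n) => (1 : ℂ)) (g := fun y => (a j y • g y) * e y)
      (v := EuclideanSpace.single j 1) (by simp) (by simpa using hI j)
      (by simpa using (hH j).continuous.integrable_of_hasCompactSupport (hHc j))
      (fun x _ => by fun_prop) (fun x _ => (hH j).differentiable (by norm_num) x)
    simpa using this
  have hpt : ∀ x, ∑ j, fderiv ℝ (fun y => (a j y • g y) * e y) x (EuclideanSpace.single j 1) =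
      phaseOp a g x * e x + (Complex.I * σ) * (g x * e x) := by
    intro x
    by_cases hx : x ∈ tsupport g
    · have hxU := hU.mem_nhds (hgU hx)
      have hΦd : HasFDerivAt Φ (fderiv ℝ Φ x) x :=
        ((hΦ.contDiffAt hxU).differentiableAt (by norm_num)).hasFDerivAt
      have hed : HasFDerivAt e (e x • ((Complex.I * σ) • (Complex.ofRealCLM.comp (fderiv ℝ Φ x)))) x := by
        have h1 : HasFDerivAt (fun x => (Φ x : ℂ)) (Complex.ofRealCLM.comp (fderiv ℝ Φ x)) x :=
          Complex.ofRealCLM.hasFDerivAt.comp x hΦd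
        exact (h1.const_mul (Complex.I * σ)).cexp
      have h2 : ∀ j, fderiv ℝ (fun y => (a j y • g y) * e y) x (EuclideanSpace.single j 1) =
          fderiv ℝ (fun y => a j y • g y) x (EuclideanSpace.single j 1) * e x +
          (Complex.I * σ) * (g x * e x) *
            ((a j x * fderiv ℝ Φ x (EuclideanSpace.single j 1) : ℝ) : ℂ) := by
        intro j
        have h3 : HasFDerivAt (fun y => (a j y • g y) * e y) _ x := ((hag j).differentiable (by norm_num) x).hasFDerivAt.mul hed
        rw [h3.fderiv]
        simp
        ring
      simp_rw [h2]
      rw [Finset.sum_add_distrib, ← Finset.mul_sum, ← Complex.ofReal_sum, haΦ x (hs hx)]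
      simp [phaseOp, Finset.sum_mul]
    · have h1 : phaseOp a g x = 0 :=
        image_eq_zero_of_notMem_tsupport fun h => hx (tsupport_phaseOp a g h)
      rw [h1, image_eq_zero_of_notMem_tsupport hx]
      simp only [zero_mul, mul_zero, add_zero]
      refine Finset.sum_eq_zero fun j _ => ?_
      have : x ∉ tsupport (fderiv ℝ (fun y => (a j y • g y) * e y)) := fun h =>
        hx (hags j (tsupport_mul_subset_left (tsupport_fderiv_subset ℝ h)))
      rw [image_eq_zero_of_notMem_tsupport this]
      rfl
  have hge : Integrable (fun x => g x * e x) :=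
    (hprod hg hgU).continuous.integrable_of_hasCompactSupport hcs.mul_right
  have hsumI : Integrable (fun x => ∑ j, fderiv ℝ (fun y => (a j y • g y) * e y) x
      (EuclideanSpace.single j 1)) := integrable_finsetSum _ fun j _ => hI j
  have hTe : ∫ x, phaseOp a g x * e x = - ((Complex.I * σ) * ∫ x, g x * e x) := by
    have h1 : ∀ x, phaseOp a g x * e x = (∑ j, fderiv ℝ (fun y => (a j y • g y) * e y) x
      (EuclideanSpace.single j 1)) - (Complex.I * σ) * (g x * e x) := by
      intro x; rw [hpt x]; ring
    simp_rw [h1]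
    rw [integral_sub hsumI (hge.const_mul _), integral_finsetSum _ fun j _ => hI j,
      integral_const_mul]
    rw [Finset.sum_eq_zero fun j _ => hzero j, zero_sub]
  rw [hTe]
  have : |σ| ≠ 0 := by linarith
  simp
  rw [← mul_assoc, inv_mul_cancel₀ this, one_mul]

lemma phase_induct {n : ℕ} {K U : Set (EuclideanSpace ℝ (Fin n))} (hK : IsCompact K) (hU : IsOpen U)
    (hKU : K ⊆ U) {a : Fin n → EuclideanSpace ℝ (Fin n) → ℝ}
    {Φ : EuclideanSpace ℝ (Fin n) → ℝ} (hΦ : ContDiffOn ℝ 1 Φ U) {p : ℕ}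
    (ha : ∀ j, ContDiffOn ℝ p (a j) U)
    (haΦ : ∀ x ∈ K, ∑ j, a j x * fderiv ℝ Φ x (EuclideanSpace.single j 1) = 1)
    {A : ℝ} (hA : 0 ≤ A) (hb : ∀ x ∈ K, ∀ j, ∀ i ≤ p, ‖iteratedFDeriv ℝ i (a j) x‖ ≤ A)
    {σ : ℝ} (hσ : 1 ≤ |σ|) (k : ℕ) : k ≤ p → ∀ g : EuclideanSpace ℝ (Fin n) → ℂ,
    ContDiff ℝ k g → tsupport g ⊆ K → 
    ‖∫ x, g x * Complex.exp (Complex.I * σ * Φ x)‖ ≤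
      (p * (n * (2 ^ p * A)) / |σ|) ^ k *
        ∫ x, ∑ i ∈ Finset.range (k + 1), ‖iteratedFDeriv ℝ i g x‖ := by
  have hσ0 : 0 < |σ| := by linarith
  have hint : ∀ (k : ℕ) (g : EuclideanSpace ℝ (Fin n) → ℂ), ContDiff ℝ k g → tsupport g ⊆ K →
      Integrable (fun x => ∑ i ∈ Finset.range (k + 1), ‖iteratedFDeriv ℝ i g x‖) := by
    intro k g hg hs
    have hcs : HasCompactSupport g := hK.of_isClosed_subset (isClosed_tsupport g) hs
    refine integrable_finsetSum _ fun i hi => Integrable.norm ?_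
    rw [Finset.mem_range] at hi
    exact (hg.continuous_iteratedFDeriv (by norm_cast; omega)).integrable_of_hasCompactSupport
      (hcs.iteratedFDeriv i)
  induction k with
  | zero =>
    intro _ g hg hs
    refine (norm_integral_le_integral_norm _).trans (le_of_eq ?_)
    simp [Complex.norm_exp]
  | succ k ih =>
    intro hk g hg hs
    have ha' : ∀ j, ContDiffOn ℝ (k + 1 : ℕ) (a j) U := fun j => (ha j).of_le (by exact_mod_cast hk)
    have h1 := phase_ibp hK hU hKU hΦ (fun j => (ha' j).of_le (by norm_cast; omega))
      (hg.of_le (by norm_cast; omega)) hs haΦ hσ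
    have hT : ContDiff ℝ k (phaseOp a g) := contDiff_phaseOp hU ha' hg (hs.trans hKU)
    have hTs := (tsupport_phaseOp a g).trans hs
    have h2 := ih (by omega) (phaseOp a g) hT hTs
    have h3 : ∫ x, ∑ i ∈ Finset.range (k + 1), ‖iteratedFDeriv ℝ i (phaseOp a g) x‖ ≤
        (p * (n * (2 ^ p * A))) * ∫ x, ∑ i ∈ Finset.range (k + 1 + 1), ‖iteratedFDeriv ℝ i g x‖ := by
      rw [← integral_const_mul]
      refine integral_mono (hint k _ hT hTs) ((hint (k + 1) g hg hs).const_mul _) fun x => ?_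
      by_cases hx : x ∈ K
      · refine (norm_phaseOp_le hU ha' hg (hs.trans hKU) hA (hKU hx)
          (fun j i hi => hb x hx j i (by omega))).trans ?_
        have hk' : ((k : ℝ) + 1) ≤ p := by exact_mod_cast hk
        gcongr
        · norm_num
      · have : ∀ i, iteratedFDeriv ℝ i (phaseOp a g) x = 0 := fun i =>
          image_eq_zero_of_notMem_tsupport fun h => hx (hTs (tsupport_iteratedFDeriv_subset i h))
        simp only [this, norm_zero, Finset.sum_const_zero]
        positivity
    refine h1.trans ?_
    calc |σ|⁻¹ * ‖∫ x, phaseOp a g x * Complex.exp (Complex.I * σ * Φ x)‖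
        ≤ |σ|⁻¹ * ((p * (n * (2 ^ p * A)) / |σ|) ^ k * ((p * (n * (2 ^ p * A))) *
          ∫ x, ∑ i ∈ Finset.range (k + 1 + 1), ‖iteratedFDeriv ℝ i g x‖)) := by
          gcongr
          exact h2.trans (by gcongr)
      _ = _ := by rw [pow_succ]; ring

/-- The coefficient `ℓ ↦ ℓ eⱼ / |ℓ|²`. -/
noncomputable def phaseCoef {n : ℕ} (j : Fin n) (l : EuclideanSpace ℝ (Fin n) →L[ℝ] ℝ) : ℝ :=
  l (EuclideanSpace.single j 1) / ∑ i, l (EuclideanSpace.single i 1) ^ 2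

lemma phaseCoef_denom_ne {n : ℕ} {l : EuclideanSpace ℝ (Fin n) →L[ℝ] ℝ} (hl : l ≠ 0) :
    ∑ i, l (EuclideanSpace.single i 1) ^ 2 ≠ 0 := by
  intro h
  apply hl
  rw [Finset.sum_eq_zero_iff_of_nonneg fun i _ => sq_nonneg _] at h
  ext x
  have h1 : x = ∑ j, (x j) • (EuclideanSpace.single j (1:ℝ)) := by
    ext l
    simp [Finset.sum_apply, Pi.single_apply]
  rw [h1, map_sum]
  simp only [map_smul, zero_apply]
  refine Finset.sum_eq_zero fun i hi => ?_
  have := h i hi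
  rw [pow_eq_zero_iff (by norm_num)] at this
  rw [this, smul_zero]

lemma phaseCoef_contDiffOn {n : ℕ} (j : Fin n) (p : ℕ) :
    ContDiffOn ℝ p (phaseCoef j) ({0}ᶜ : Set (EuclideanSpace ℝ (Fin n) →L[ℝ] ℝ)) := by
  refine ContDiffOn.div ?_ ?_ fun l hl => phaseCoef_denom_ne hl
  · exact (ContDiff.clm_apply contDiff_id contDiff_const).contDiffOn
  · exact (ContDiff.sum fun i _ => (ContDiff.clm_apply contDiff_id contDiff_const).pow 2).contDiffOn

lemma phaseCoef_bound (n p : ℕ) {c : ℝ} (hc : 0 < c) (R : ℝ) : ∃ C : ℝ, 0 ≤ C ∧ ∀ j : Fin n,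
    ∀ i ≤ p, ∀ l : EuclideanSpace ℝ (Fin n) →L[ℝ] ℝ, c ≤ ‖l‖ → ‖l‖ ≤ R →
      ‖iteratedFDerivWithin ℝ i (phaseCoef j) {0}ᶜ l‖ ≤ C := by
  have hcomp : IsCompact {l : EuclideanSpace ℝ (Fin n) →L[ℝ] ℝ | c ≤ ‖l‖ ∧ ‖l‖ ≤ R} := by
    have : ProperSpace (EuclideanSpace ℝ (Fin n) →L[ℝ] ℝ) := FiniteDimensional.proper ℝ _
    refine (isCompact_closedBall (0 : EuclideanSpace ℝ (Fin n) →L[ℝ] ℝ) R).of_isClosed_subset ?_ ?_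
    · exact (isClosed_le continuous_const continuous_norm).inter
        (isClosed_le continuous_norm continuous_const)
    · intro l hl; simpa using hl.2
  have hex : ∀ (j : Fin n) (i : ℕ), ∃ C : ℝ, 0 ≤ C ∧ ∀ l : EuclideanSpace ℝ (Fin n) →L[ℝ] ℝ,
      c ≤ ‖l‖ → ‖l‖ ≤ R → ‖iteratedFDerivWithin ℝ i (phaseCoef j) {0}ᶜ l‖ ≤ C := by
    intro j i
    have hcont := (phaseCoef_contDiffOn j i).continuousOn_iteratedFDerivWithin (m := i) le_rfl
      isOpen_compl_singleton.uniqueDiffOn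
    obtain ⟨C, hC⟩ := hcomp.exists_bound_of_continuousOn (hcont.mono fun l hl => by
      intro h
      rw [Set.mem_singleton_iff] at h
      have := hl.1
      rw [h, norm_zero] at this
      linarith)
    exact ⟨max C 0, le_max_right _ _, fun l h1 h2 => (hC l ⟨h1, h2⟩).trans (le_max_left _ _)⟩
  choose C hC0 hC using hex
  refine ⟨∑ j, ∑ i ∈ Finset.range (p + 1), C j i,
    Finset.sum_nonneg fun j _ => Finset.sum_nonneg fun i _ => hC0 j i, ?_⟩
  intro j i hi l h1 h2
  refine (hC j i l h1 h2).trans ?_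
  refine (Finset.single_le_sum (f := fun i => C j i) (fun i _ => hC0 j i)
    (Finset.mem_range.2 (Nat.lt_succ_of_le hi))).trans ?_
  exact Finset.single_le_sum (f := fun j => ∑ i ∈ Finset.range (p + 1), C j i)
    (fun j _ => Finset.sum_nonneg fun i _ => hC0 j i) (Finset.mem_univ j)

/-- **Non-stationary phase estimate.**  Let `K ⊆ ℝⁿ` be compact, `N ≥ 2`, and let `Φ` be a
real-valued `C^N` function on an open neighborhood of `K` with `|∇Φ| ≥ c > 0` on `K` and
`|∂^α Φ| ≤ M` on `K` for all `|α| ≤ N`. Then there is `C > 0` depending only on `n, N, c, M`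
such that for every `σ` with `|σ| ≥ 1` and every `C^{N−1}` function `f : ℝⁿ → ℂ` with compact
support contained in `K`,
`| ∫ f(x) e^{iσΦ(x)} dx | ≤ C |σ|^{1−N} Σ_{|α| ≤ N−1} ∫ |∂^α f|`. -/
theorem stmt3 (n N : ℕ) (hn : 1 ≤ n) (hN : 2 ≤ N) (c M : ℝ) (hc : 0 < c) :
    ∃ C > 0, ∀ (K U : Set (EuclideanSpace ℝ (Fin n))), IsCompact K → IsOpen U → K ⊆ U →
      ∀ (Φ : EuclideanSpace ℝ (Fin n) → ℝ), ContDiffOn ℝ N Φ U →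
      (∀ x ∈ K, c ≤ ‖fderiv ℝ Φ x‖) →
      (∀ α : Fin n → ℕ, (∑ i, α i) ≤ N → ∀ x ∈ K, |mderiv α Φ x| ≤ M) →
      ∀ (f : EuclideanSpace ℝ (Fin n) → ℂ), ContDiff ℝ (N - 1 : ℕ) f → tsupport f ⊆ K →
      ∀ σ : ℝ, 1 ≤ |σ| →
        ‖∫ x, f x * Complex.exp (Complex.I * σ * Φ x)‖
          ≤ C * |σ| ^ ((1 : ℝ) - N) *
            ∑ α : Fin n → Fin N, (if (∑ i, (α i : ℕ)) ≤ N - 1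
              then ∫ x, ‖mderiv (fun i => ((α i : ℕ))) f x‖ else 0) := by
  obtain ⟨p, rfl⟩ : ∃ p, N = p + 1 := ⟨N - 1, by omega⟩
  have hp1 : p + 1 - 1 = p := by omega
  rw [hp1]
  have hn1 : (1 : ℝ) ≤ n := by exact_mod_cast hn
  set R : ℝ := n ^ (p + 1) * max M 1 with hR
  have hR1 : 1 ≤ R := by
    have h1 : (1 : ℝ) ≤ n ^ (p + 1) := one_le_pow₀ hn1
    have h2 : (1 : ℝ) ≤ max M 1 := le_max_right _ _
    nlinarith
  obtain ⟨C, hC0, hC⟩ := phaseCoef_bound n p hc R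
  set A : ℝ := (p.factorial : ℝ) * C * R ^ p with hA
  have hA0 : 0 ≤ A := by positivity
  set B : ℝ := p * (n * (2 ^ p * A)) with hB
  have hB0 : 0 ≤ B := by positivity
  refine ⟨B ^ p * ((p + 1) * n ^ p) + 1, by positivity, ?_⟩
  intro K U hK hU hKU Φ hΦ hcΦ hMΦ f hf hs σ hσ
  have hσ0 : 0 < |σ| := by linarith
  -- bounds on the phase
  have hΦb : ∀ x ∈ K, ∀ i ≤ p + 1, ‖iteratedFDeriv ℝ i Φ x‖ ≤ R := by
    intro x hx i hi
    refine (norm_iteratedFDeriv_le_mderiv hU hΦ hi (hKU hx) (max M 1) ?_).trans ?_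
    · intro α hα
      exact (hMΦ α (by omega) x hx).trans (le_max_left _ _)
    · rw [hR]
      gcongr
  have hdΦ : ContDiffOn ℝ p (fderiv ℝ Φ) U := hΦ.fderiv_of_isOpen hU (by norm_cast)
  set V : Set (EuclideanSpace ℝ (Fin n)) := U ∩ (fderiv ℝ Φ) ⁻¹' {0}ᶜ with hV
  have hVo : IsOpen V := hdΦ.continuousOn.isOpen_inter_preimage hU isOpen_compl_singleton
  have hne : ∀ x ∈ K, fderiv ℝ Φ x ≠ 0 := by
    intro x hx h
    have := hcΦ x hx
    rw [h, norm_zero] at this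
    linarith
  have hKV : K ⊆ V := fun x hx => ⟨hKU hx, hne x hx⟩
  have hdV : ContDiffOn ℝ p (fderiv ℝ Φ) V := hdΦ.mono Set.inter_subset_left
  have hmaps : Set.MapsTo (fderiv ℝ Φ) V {0}ᶜ := fun x hx => hx.2
  have ha : ∀ j, ContDiffOn ℝ p (phaseCoef j ∘ fderiv ℝ Φ) V := fun j =>
    (phaseCoef_contDiffOn j p).comp hdV hmaps
  have hab : ∀ x ∈ K, ∀ j, ∀ i ≤ p, ‖iteratedFDeriv ℝ i (phaseCoef j ∘ fderiv ℝ Φ) x‖ ≤ A := by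
    intro x hx j i hi
    have hxV := hKV hx
    rw [← iteratedFDerivWithin_of_isOpen _ hVo hxV]
    have h1 : ‖fderiv ℝ Φ x‖ ≤ R := by
      have := hΦb x hx 1 (by omega)
      rwa [norm_iteratedFDeriv_one] at this
    refine (norm_iteratedFDerivWithin_comp_le (phaseCoef_contDiffOn j p) hdV
      (by exact_mod_cast hi) isOpen_compl_singleton.uniqueDiffOn hVo.uniqueDiffOn hmaps hxV
      (C := C) (D := R) (fun q hq => hC j q (by omega) _ (hcΦ x hx) h1) ?_).trans ?_
    · intro q hq1 hq
      rw [iteratedFDerivWithin_of_isOpen _ hVo hxV, norm_iteratedFDeriv_fderiv]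
      exact (hΦb x hx (q + 1) (by omega)).trans (le_self_pow₀ hR1 (by omega))
    · rw [hA]
      have := Nat.factorial_le hi
      gcongr
  have haΦ : ∀ x ∈ K, ∑ j, (phaseCoef j ∘ fderiv ℝ Φ) x *
      fderiv ℝ Φ x (EuclideanSpace.single j 1) = 1 := by
    intro x hx
    have h1 := phaseCoef_denom_ne (hne x hx)
    simp only [Function.comp, phaseCoef]
    refine Eq.trans ?_ (div_self h1)
    rw [Finset.sum_div]
    refine Finset.sum_congr rfl fun j _ => ?_
    rw [div_mul_eq_mul_div, sq]
  have hmain := phase_induct hK hVo hKV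
    ((hΦ.mono Set.inter_subset_left).of_le (by norm_cast; omega)) ha haΦ hA0 hab hσ p le_rfl f hf hs
  -- from iterated derivatives to partial derivatives
  set S : EuclideanSpace ℝ (Fin n) → ℝ := fun x => ∑ α : Fin n → Fin (p + 1),
    (if (∑ i, (α i : ℕ)) ≤ p then ‖mderiv (fun i => ((α i : ℕ))) f x‖ else 0) with hS
  have hcs : HasCompactSupport f := hK.of_isClosed_subset (isClosed_tsupport f) hs
  have hmd : ∀ α : Fin n → ℕ, ∑ i, α i ≤ p → Integrable (fun x => ‖mderiv α f x‖) := by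
    intro α hα
    set L := (List.finRange n).flatMap fun i => List.replicate (α i) i with hL
    have hlen : L.length ≤ p := by
      rw [hL, List.length_flatMap, ← List.ofFn_eq_map, List.sum_ofFn]
      simpa using hα
    have h1 : mderiv α f = fun x =>
        iteratedFDeriv ℝ L.length f x (fun i => EuclideanSpace.single (L.get i) 1) := by
      funext x
      exact pderivList_eq_iteratedFDeriv isOpen_univ hf.contDiffOn L hlen x (Set.mem_univ x)
    rw [h1]
    refine Integrable.norm ?_
    have hc1 := hf.continuous_iteratedFDeriv (m := L.length) (by exact_mod_cast hlen)
    refine Continuous.integrable_of_hasCompactSupport ?_ ?_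
    · exact (ContinuousMultilinearMap.apply ℝ _ ℂ _).continuous.comp hc1
    · refine (hcs.iteratedFDeriv (𝕜 := ℝ) L.length).mono fun x hx h => hx ?_
      simp only
      rw [h]
      rfl
  have hSterm : ∀ α : Fin n → Fin (p + 1), Integrable (fun x =>
      (if (∑ i, (α i : ℕ)) ≤ p then ‖mderiv (fun i => ((α i : ℕ))) f x‖ else 0)) := by
    intro α
    split_ifs with h
    · exact hmd _ h
    · exact integrable_zero _ _ _
  have hSint : Integrable S := integrable_finsetSum _ fun α _ => hSterm α
  have hSeq : ∫ x, S x = ∑ α : Fin n → Fin (p + 1), (if (∑ i, (α i : ℕ)) ≤ p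
              then ∫ x, ‖mderiv (fun i => ((α i : ℕ))) f x‖ else 0) := by
    rw [hS, integral_finsetSum _ fun α _ => hSterm α]
    refine Finset.sum_congr rfl fun α _ => ?_
    split_ifs <;> simp
  have hS0 : ∀ x, 0 ≤ S x := fun x => Finset.sum_nonneg fun α _ => by positivity
  have hDf : ∀ x, ∑ i ∈ Finset.range (p + 1), ‖iteratedFDeriv ℝ i f x‖ ≤ ((p + 1) * n ^ p) * S x := by
    intro x
    have : ∀ i ∈ Finset.range (p + 1), ‖iteratedFDeriv ℝ i f x‖ ≤ n ^ p * S x := by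
      intro i hi
      rw [Finset.mem_range] at hi
      refine (norm_iteratedFDeriv_le_mderiv isOpen_univ hf.contDiffOn (by omega : i ≤ p)
        (Set.mem_univ x) (S x) ?_).trans ?_
      · intro α hα
        have hlt : ∀ i, α i < p + 1 := fun l =>
          (Finset.single_le_sum (f := α) (fun _ _ => Nat.zero_le _) (Finset.mem_univ l)).trans_lt
            (by omega)
        have := Finset.single_le_sum (f := fun α : Fin n → Fin (p + 1) =>
          (if (∑ i, (α i : ℕ)) ≤ p then ‖mderiv (fun i => ((α i : ℕ))) f x‖ else 0))
          (fun α _ => by positivity) (Finset.mem_univ (fun i => (⟨α i, hlt i⟩ : Fin (p + 1))))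
        simp only at this
        rw [if_pos (by omega)] at this
        exact this
      · have := hS0 x
        gcongr
        omega
    refine (Finset.sum_le_sum this).trans (le_of_eq ?_)
    simp
    ring
  have hint : ∫ x, ∑ i ∈ Finset.range (p + 1), ‖iteratedFDeriv ℝ i f x‖ ≤
      ((p + 1) * n ^ p) * ∫ x, S x := by
    rw [← integral_const_mul]
    exact integral_mono_of_nonneg (Filter.Eventually.of_forall fun x => by positivity)
      (hSint.const_mul _) (Filter.Eventually.of_forall hDf)
  have hIS : 0 ≤ ∫ x, S x := integral_nonneg hS0
  rw [← hSeq]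
  have hpow : |σ| ^ ((1 : ℝ) - ((p + 1 : ℕ) : ℝ)) = (|σ| ^ p)⁻¹ := by
    rw [show (1 : ℝ) - ((p + 1 : ℕ) : ℝ) = -(p : ℝ) by push_cast; ring,
      Real.rpow_neg hσ0.le, Real.rpow_natCast]
  rw [hpow]
  calc _ ≤ _ := hmain
    _ ≤ (B / |σ|) ^ p * (((p + 1) * n ^ p) * ∫ x, S x) := by gcongr
    _ = (B ^ p * ((p + 1) * n ^ p)) * (|σ| ^ p)⁻¹ * ∫ x, S x := by rw [div_pow]; ring
    _ ≤ _ := by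
      gcongr
      linarith
end

section
/- Let n ≥ 1, let σ > 0, and let A ∈ ℝ^{n×n} be symmetric and invertible. Then for every Schwartz function h on ℝⁿ one has ∫_{ℝⁿ} e^{iσ⟨x,Ax⟩} (𝓕h)(x) dx = (2σ)^{−n/2} |det A|^{−1/2} e^{iπ sgn(A)/4} ∫_{ℝⁿ} e^{−i⟨ξ,A^{−1}ξ⟩/(4σ)} h(ξ) dξ, both integrals being absolutely convergent. Equivalently, the Fourier transform of the tempered distribution x ↦ e^{iσ⟨x,Ax⟩} is the bounded function ξ ↦ (2σ)^{−n/2} |det A|^{−1/2} e^{iπ sgn(A)/4} e^{−i⟨ξ,A^{−1}ξ⟩/(4σ)}. -/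
open MeasureTheory

/-- The quadratic form `x ↦ ⟨x, Ax⟩` on `ℝⁿ`. -/
noncomputable def quadForm {n : ℕ} (A : Matrix (Fin n) (Fin n) ℝ)
    (x : EuclideanSpace ℝ (Fin n)) : ℝ :=
  ∑ i, x i * ∑ j, A i j * x j

open scoped Classical in
/-- The signature of a real symmetric matrix: the number of positive eigenvalues minus the
number of negative eigenvalues (counted with multiplicity). -/
noncomputable def matSgn {n : ℕ} (A : Matrix (Fin n) (Fin n) ℝ) : ℤ :=
  if hA : A.IsHermitian then
    ((Finset.univ.filter fun i => 0 < hA.eigenvalues i).card : ℤ)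
      - ((Finset.univ.filter fun i => hA.eigenvalues i < 0).card : ℤ)
  else 0

/-- The Fourier transform with the normalization `𝓕h(ξ) = (2π)^{−n/2} ∫ h(x) e^{−i⟨x,ξ⟩} dx`. -/
noncomputable def FT {n : ℕ} (h : EuclideanSpace ℝ (Fin n) → ℂ)
    (ξ : EuclideanSpace ℝ (Fin n)) : ℂ :=
  ((2 * Real.pi) ^ (-(n : ℝ) / 2) : ℝ) * ∫ x, h x * Complex.exp (-(Complex.I * ∑ i, x i * ξ i))


open Filter Topology

lemma quadForm_basis {n : ℕ} (B : Matrix (Fin n) (Fin n) ℝ)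
    (b : OrthonormalBasis (Fin n) ℝ (EuclideanSpace ℝ (Fin n))) (l : Fin n → ℝ)
    (hb : ∀ j, B.toEuclideanLin (b j) = l j • b j) (v : EuclideanSpace ℝ (Fin n)) :
    quadForm B (b.repr.symm v) = ∑ i, l i * v i ^ 2 := by
  have h1 : ∀ x, quadForm B x = inner ℝ x (B.toEuclideanLin x) := by
    intro x
    simp [quadForm, PiLp.inner_apply, Matrix.toLpLin_apply, Matrix.mulVec, dotProduct, mul_comm]
  have h2 : B.toEuclideanLin (b.repr.symm v) = b.repr.symm (WithLp.toLp 2 fun i => l i * v i) := by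
    rw [← b.sum_repr_symm, ← b.sum_repr_symm, map_sum]
    refine Finset.sum_congr rfl fun i _ => ?_
    rw [map_smul, hb, smul_smul, mul_comm]
  rw [h1, h2, LinearIsometryEquiv.inner_map_map]
  simp [PiLp.inner_apply]
  refine Finset.sum_congr rfl fun i _ => by ring

lemma FT_comp {n : ℕ} (e : EuclideanSpace ℝ (Fin n) ≃ₗᵢ[ℝ] EuclideanSpace ℝ (Fin n))
    (h : EuclideanSpace ℝ (Fin n) → ℂ) (x : EuclideanSpace ℝ (Fin n)) :
    FT (fun y => h (e y)) x = FT h (e x) := by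
  have h1 : ∀ x y : EuclideanSpace ℝ (Fin n), (∑ i, x i * y i) = inner ℝ x y := by
    intro x y
    simp [PiLp.inner_apply, mul_comm]
  unfold FT
  simp_rw [h1]
  congr 1
  rw [← e.measurePreserving.integral_comp e.toHomeomorph.measurableEmbedding
    (fun y => h y * Complex.exp (-(Complex.I * (inner ℝ y (e x) : ℝ))))]
  simp

lemma FT_integrable {n : ℕ} (h : SchwartzMap (EuclideanSpace ℝ (Fin n)) ℂ) :
    Integrable (FT (fun y => h y)) := by
  have h0 : Integrable (fun x => (FourierTransform.fourier h : SchwartzMap _ ℂ) x) :=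
    SchwartzMap.integrable _
  have h1 := h0.comp_smul (R := (2 * Real.pi)⁻¹) (by positivity)
  have h2 := h1.const_mul (((2 * Real.pi) ^ (-(n : ℝ) / 2) : ℝ) : ℂ)
  refine h2.congr (ae_of_all _ fun x => ?_)
  simp only [FT]
  congr 1
  rw [SchwartzMap.fourier_coe, Real.fourier_eq']
  congr 1
  ext v
  rw [smul_eq_mul, mul_comm]
  congr 2
  simp [PiLp.inner_apply, Finset.mul_sum, Finset.sum_mul]
  refine Finset.sum_congr rfl fun i _ => ?_
  have : (Real.pi : ℂ) ≠ 0 := by exact_mod_cast Real.pi_ne_zero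
  field_simp

lemma gauss_integrable {n : ℕ} (b : Fin n → ℂ) (hb : ∀ i, 0 < (b i).re) :
    Integrable (fun x : EuclideanSpace ℝ (Fin n) => Complex.exp (-∑ i, b i * (x i : ℂ) ^ 2)) := by
  rw [← (PiLp.volume_preserving_toLp (Fin n)).integrable_comp_emb
    (MeasurableEquiv.toLp 2 _).measurableEmbedding]
  simpa [Function.comp_def] using GaussianFourier.integrable_cexp_neg_sum_mul_add hb (fun _ => 0)

lemma gauss_fourier {n : ℕ} (b : Fin n → ℂ) (hb : ∀ i, 0 < (b i).re)
    (y : EuclideanSpace ℝ (Fin n)) :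
    ∫ x : EuclideanSpace ℝ (Fin n), Complex.exp (-∑ i, b i * (x i : ℂ) ^ 2) *
      Complex.exp (-(Complex.I * ((∑ i, y i * x i : ℝ) : ℂ)))
    = (∏ i, (Real.pi / b i) ^ (1 / 2 : ℂ)) * Complex.exp (-∑ i, (y i : ℂ) ^ 2 / (4 * b i)) := by
  rw [← (PiLp.volume_preserving_toLp (Fin n)).integral_comp
    (MeasurableEquiv.toLp 2 _).measurableEmbedding]
  have := GaussianFourier.integral_cexp_neg_sum_mul_add hb (fun i => -(Complex.I * y i))
  rw [Finset.prod_mul_distrib, ← Complex.exp_sum] at this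
  refine Eq.trans ?_ (this.trans ?_)
  · congr 1
    ext v
    rw [← Complex.exp_add]
    simp [Finset.mul_sum, mul_assoc]
  · rw [← Finset.sum_neg_distrib]
    congr 2
    refine Finset.sum_congr rfl fun i _ => ?_
    rw [neg_sq, mul_pow, Complex.I_sq]; ring

lemma regularized {n : ℕ} (b : Fin n → ℂ) (hb : ∀ i, 0 < (b i).re)
    (h : EuclideanSpace ℝ (Fin n) → ℂ) (hh : Integrable h) :
    ∫ x, Complex.exp (-∑ i, b i * (x i : ℂ) ^ 2) * FT h x =
      (((2 * Real.pi) ^ (-(n : ℝ) / 2) : ℝ) : ℂ) * (∏ i, (Real.pi / b i) ^ (1 / 2 : ℂ)) *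
        ∫ y, Complex.exp (-∑ i, (y i : ℂ) ^ 2 / (4 * b i)) * h y := by
  have hF : Integrable (fun z : EuclideanSpace ℝ (Fin n) × EuclideanSpace ℝ (Fin n) =>
      Complex.exp (-(Complex.I * ∑ i, z.2 i * z.1 i)) *
      (Complex.exp (-∑ i, b i * (z.1 i : ℂ) ^ 2) * h z.2)) (volume.prod volume) := by
    refine ((gauss_integrable b hb).mul_prod hh).bdd_mul (c := 1) ?_ ?_
    · exact Continuous.aestronglyMeasurable (by fun_prop)
    · refine ae_of_all _ fun z => ?_
      rw [Complex.norm_exp]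
      simp
  calc _ = (((2 * Real.pi) ^ (-(n : ℝ) / 2) : ℝ) : ℂ) * ∫ x : EuclideanSpace ℝ (Fin n), ∫ y : EuclideanSpace ℝ (Fin n),
      Complex.exp (-(Complex.I * ∑ i, y i * x i)) *
      (Complex.exp (-∑ i, b i * (x i : ℂ) ^ 2) * h y) := by
        rw [← integral_const_mul]
        congr 1; ext x
        simp only [FT]
        rw [← integral_const_mul, ← integral_const_mul, ← integral_const_mul]
        congr 1; ext y
        ring
    _ = _ := by
        rw [integral_integral_swap hF, mul_assoc]
        congr 1
        rw [← integral_const_mul]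
        congr 1; ext y
        rw [← mul_assoc, ← gauss_fourier b hb, ← integral_mul_const]
        congr 1; ext x
        ring

lemma const_eval {l : ℝ} (hl : l ≠ 0) {σ : ℝ} (hσ : 0 < σ) :
    (Real.pi / (-(Complex.I * σ * l)) : ℂ) ^ (1 / 2 : ℂ) =
      (((2 * Real.pi) ^ (1 / 2 : ℝ) * (2 * σ) ^ (-(1 / 2) : ℝ) * |l| ^ (-(1 / 2) : ℝ) : ℝ) : ℂ) *
        Complex.exp (Complex.I * Real.pi * ((if 0 < l then 1 else 0) - (if l < 0 then 1 else 0)) / 4) := by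
  have hr : (2 * Real.pi) ^ (1 / 2 : ℝ) * (2 * σ) ^ (-(1 / 2) : ℝ) * |l| ^ (-(1 / 2) : ℝ)
      = (Real.pi / (σ * |l|)) ^ (1 / 2 : ℝ) := by
    have := Real.pi_pos
    have hl' := abs_pos.2 hl
    rw [Real.rpow_neg (by positivity), Real.rpow_neg (by positivity), ← div_eq_mul_inv,
      ← div_eq_mul_inv, ← Real.div_rpow (by positivity) (by positivity),
      ← Real.div_rpow (by positivity) (by positivity)]
    congr 1
    field_simp
  have hpos : 0 < Real.pi / (σ * |l|) := by
    have := Real.pi_pos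
    have hl' := abs_pos.2 hl
    positivity
  rw [hr]
  have hσ' : (σ : ℂ) ≠ 0 := by exact_mod_cast hσ.ne'
  have hlc : (l : ℂ) ≠ 0 := by exact_mod_cast hl
  rcases lt_or_gt_of_ne hl with h | h
  · have : (Real.pi / (-(Complex.I * σ * l)) : ℂ) = ((Real.pi / (σ * |l|) : ℝ) : ℂ) * (-Complex.I) := by
      rw [abs_of_neg h]; push_cast; field_simp; simp
    rw [this, Complex.cpow_def_of_ne_zero (by simp [hσ.ne', hl, Real.pi_ne_zero]),
      Complex.log_ofReal_mul hpos (by simp), Complex.log_neg_I, Real.rpow_def_of_pos hpos,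
      Complex.ofReal_exp, ← Complex.exp_add]
    congr 1
    simp [h, h.not_gt]
    ring
  · have : (Real.pi / (-(Complex.I * σ * l)) : ℂ) = ((Real.pi / (σ * |l|) : ℝ) : ℂ) * Complex.I := by
      rw [abs_of_pos h]; push_cast; field_simp; simp
    rw [this, Complex.cpow_def_of_ne_zero (by simp [hσ.ne', hl, Real.pi_ne_zero]),
      Complex.log_ofReal_mul hpos (by simp), Complex.log_I, Real.rpow_def_of_pos hpos,
      Complex.ofReal_exp, ← Complex.exp_add]
    congr 1
    simp [h, h.not_gt]
    ring

lemma diag_const {n : ℕ} {l : Fin n → ℝ} (hl : ∀ i, l i ≠ 0) {σ : ℝ} (hσ : 0 < σ) :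
    (((2 * Real.pi) ^ (-(n : ℝ) / 2) : ℝ) : ℂ) *
      (∏ i, (Real.pi / (-(Complex.I * σ * l i)) : ℂ) ^ (1 / 2 : ℂ)) =
    (((2 * σ) ^ (-(n : ℝ) / 2) : ℝ) : ℂ) * ((|∏ i, l i| ^ (-(1/2) : ℝ) : ℝ) : ℂ)
          * Complex.exp (Complex.I * Real.pi *
            (∑ i, ((if 0 < l i then 1 else 0) - (if l i < 0 then 1 else 0))) / 4) := by
  have hpi := Real.pi_pos
  simp_rw [const_eval (hl _) hσ]
  rw [Finset.prod_mul_distrib, ← Complex.exp_sum, ← Complex.ofReal_prod, Finset.prod_mul_distrib,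
    Finset.prod_const, Finset.card_univ, Fintype.card_fin, ← mul_assoc, ← Complex.ofReal_mul,
    ← Complex.ofReal_mul, Finset.mul_sum, Finset.sum_div]
  congr 2
  rw [Finset.abs_prod, Real.finsetProd_rpow _ _ (fun i _ => abs_nonneg _), mul_pow,
    ← Real.rpow_natCast, ← Real.rpow_natCast, ← Real.rpow_mul (by positivity),
    ← Real.rpow_mul (by positivity), ← mul_assoc, ← mul_assoc, ← Real.rpow_add (by positivity)]
  have e1 : -(n : ℝ) / 2 + 1 / 2 * n = 0 := by ring
  have e2 : -(1 / 2) * (n : ℝ) = -n / 2 := by ring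
  rw [e1, e2, Real.rpow_zero, one_mul]

lemma diag {n : ℕ} {l : Fin n → ℝ} (hl : ∀ i, l i ≠ 0) {σ : ℝ} (hσ : 0 < σ)
    (h : EuclideanSpace ℝ (Fin n) → ℂ) (hh : Integrable h) (hF : Integrable (FT h)) :
    ∫ x, Complex.exp (Complex.I * σ * ((∑ i, l i * x i ^ 2 : ℝ) : ℂ)) * FT h x =
      (((2 * σ) ^ (-(n : ℝ) / 2) : ℝ) : ℂ) * ((|∏ i, l i| ^ (-(1/2) : ℝ) : ℝ) : ℂ)
          * Complex.exp (Complex.I * Real.pi *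
            (∑ i, ((if 0 < l i then 1 else 0) - (if l i < 0 then 1 else 0))) / 4)
          * ∫ y, Complex.exp (-(Complex.I * ((∑ i, (l i)⁻¹ * y i ^ 2 : ℝ) : ℂ) / (4 * σ))) * h y := by
  have hσ' : (σ : ℂ) ≠ 0 := by exact_mod_cast hσ.ne'
  have hlc : ∀ i, (l i : ℂ) ≠ 0 := fun i => by exact_mod_cast hl i
  let b : ℝ → Fin n → ℂ := fun ε i => ε + -(Complex.I * σ * l i)
  have hb : ∀ ε, 0 < ε → ∀ i, 0 < (b ε i).re := by
    intro ε hε i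
    simpa [b] using hε
  have hb0 : ∀ i, b 0 i = -(Complex.I * σ * l i) := by simp [b]
  have hb0' : ∀ i, b 0 i ≠ 0 := by
    intro i
    simp [hb0, hσ', hlc i]
  have hbc : ∀ i, Tendsto (fun ε => b ε i) (𝓝[>] 0) (𝓝 (b 0 i)) := by
    intro i
    have : Continuous (fun ε => b ε i) := by fun_prop
    exact this.continuousAt.tendsto.mono_left nhdsWithin_le_nhds
  have L : Tendsto (fun ε => ∫ x : EuclideanSpace ℝ (Fin n),
      Complex.exp (-∑ i, b ε i * (x i : ℂ) ^ 2) * FT h x) (𝓝[>] 0)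
      (𝓝 (∫ x : EuclideanSpace ℝ (Fin n),
        Complex.exp (-∑ i, b 0 i * (x i : ℂ) ^ 2) * FT h x)) := by
    refine tendsto_integral_filter_of_dominated_convergence (fun x => ‖FT h x‖) ?_ ?_ hF.norm ?_
    · refine Eventually.of_forall fun ε => ?_
      exact (Continuous.aestronglyMeasurable (by fun_prop)).mul hF.1
    · filter_upwards [self_mem_nhdsWithin] with ε hε
      refine ae_of_all _ fun x => ?_
      rw [norm_mul]
      refine mul_le_of_le_one_left (norm_nonneg _) ?_
      rw [Complex.norm_exp, Real.exp_le_one_iff, Complex.neg_re, Complex.re_sum, neg_nonpos]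
      refine Finset.sum_nonneg fun i _ => ?_
      rw [← Complex.ofReal_pow, Complex.re_mul_ofReal]
      exact mul_nonneg (hb ε hε i).le (sq_nonneg _)
    · refine ae_of_all _ fun x => ?_
      refine Tendsto.mul_const _ (Tendsto.cexp ?_)
      exact (tendsto_finsetSum _ fun i _ => (hbc i).mul_const _).neg
  have R : Tendsto (fun ε => ∫ x : EuclideanSpace ℝ (Fin n),
      Complex.exp (-∑ i, (x i : ℂ) ^ 2 / (4 * b ε i)) * h x) (𝓝[>] 0)
      (𝓝 (∫ x : EuclideanSpace ℝ (Fin n),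
        Complex.exp (-∑ i, (x i : ℂ) ^ 2 / (4 * b 0 i)) * h x)) := by
    refine tendsto_integral_filter_of_dominated_convergence (fun x => ‖h x‖) ?_ ?_ hh.norm ?_
    · refine Eventually.of_forall fun ε => ?_
      exact (Continuous.aestronglyMeasurable (by fun_prop)).mul hh.1
    · filter_upwards [self_mem_nhdsWithin] with ε hε
      refine ae_of_all _ fun x => ?_
      rw [norm_mul]
      refine mul_le_of_le_one_left (norm_nonneg _) ?_
      rw [Complex.norm_exp, Real.exp_le_one_iff, Complex.neg_re, Complex.re_sum, neg_nonpos]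
      refine Finset.sum_nonneg fun i _ => ?_
      have : (x i : ℂ) ^ 2 / (4 * b ε i) = (b ε i)⁻¹ * ((x i ^ 2 / 4 : ℝ) : ℂ) := by
        push_cast
        ring
      rw [this, Complex.re_mul_ofReal, Complex.inv_re]
      exact mul_nonneg (div_nonneg (hb ε hε i).le (Complex.normSq_nonneg _)) (by positivity)
    · refine ae_of_all _ fun x => ?_
      refine Tendsto.mul_const _ (Tendsto.cexp ?_)
      refine (tendsto_finsetSum _ fun i _ => ?_).neg
      exact tendsto_const_nhds.div ((hbc i).const_mul _) (mul_ne_zero (by norm_num) (hb0' i))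
  have C : Tendsto (fun ε => ∏ i, (Real.pi / b ε i : ℂ) ^ (1 / 2 : ℂ)) (𝓝[>] 0)
      (𝓝 (∏ i, (Real.pi / b 0 i : ℂ) ^ (1 / 2 : ℂ))) := by
    refine tendsto_finsetProd _ fun i _ => ?_
    refine Tendsto.cpow (tendsto_const_nhds.div (hbc i) (hb0' i)) tendsto_const_nhds ?_
    right
    rw [hb0]
    have : (Real.pi / (-(Complex.I * σ * l i)) : ℂ) = ((Real.pi / (σ * l i) : ℝ) : ℂ) * Complex.I := by
      have := hlc i
      push_cast; field_simp; simp
    rw [this, Complex.im_ofReal_mul, Complex.I_im, mul_one]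
    exact div_ne_zero Real.pi_ne_zero (mul_ne_zero hσ.ne' (hl i))
  have key := tendsto_nhds_unique_of_eventuallyEq L ((C.const_mul
    (((2 * Real.pi) ^ (-(n : ℝ) / 2) : ℝ) : ℂ)).mul R) (by
      filter_upwards [self_mem_nhdsWithin] with ε hε
      exact regularized (b ε) (hb ε hε) h hh)
  simp_rw [hb0] at key
  rw [diag_const hl hσ] at key
  refine Eq.trans ?_ (key.trans ?_)
  · congr 1; ext x
    congr 2
    push_cast
    rw [Finset.mul_sum, ← Finset.sum_neg_distrib]
    refine Finset.sum_congr rfl fun i _ => by ring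
  · congr 2; ext y
    congr 2
    push_cast
    rw [Finset.mul_sum, Finset.sum_div]
    congr 1
    refine Finset.sum_congr rfl fun i _ => ?_
    have := hlc i
    field_simp
    simp
/-- **Fourier transform of a Fresnel-type quadratic exponential.** For `σ > 0` and `A` symmetric
and invertible, `∫ e^{iσ⟨x,Ax⟩} 𝓕h(x) dx
  = (2σ)^{−n/2} |det A|^{−1/2} e^{iπ sgn(A)/4} ∫ e^{−i⟨ξ,A⁻¹ξ⟩/(4σ)} h(ξ) dξ`
for every Schwartz function `h`, both integrals being absolutely convergent. -/
theorem stmt5 (n : ℕ) (hn : 1 ≤ n) (σ : ℝ) (hσ : 0 < σ)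
    (A : Matrix (Fin n) (Fin n) ℝ) (hA : A.IsSymm) (hdet : IsUnit A.det)
    (h : SchwartzMap (EuclideanSpace ℝ (Fin n)) ℂ) :
    Integrable (fun x => Complex.exp (Complex.I * σ * quadForm A x) * FT (fun y => h y) x) ∧
    Integrable (fun ξ : EuclideanSpace ℝ (Fin n) =>
      Complex.exp (-(Complex.I * quadForm A⁻¹ ξ / (4 * σ))) * h ξ) ∧
    (∫ x, Complex.exp (Complex.I * σ * quadForm A x) * FT (fun y => h y) x)
      = (((2 * σ) ^ (-(n : ℝ) / 2) : ℝ) : ℂ) * ((|A.det| ^ (-(1/2) : ℝ) : ℝ) : ℂ)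
          * Complex.exp (Complex.I * Real.pi * (matSgn A : ℂ) / 4)
          * ∫ ξ, Complex.exp (-(Complex.I * quadForm A⁻¹ ξ / (4 * σ))) * h ξ := by

  have hH : A.IsHermitian := by
    rw [Matrix.IsHermitian, Matrix.conjTranspose_eq_transpose_of_trivial]; exact hA
  set l := hH.eigenvalues with hldef
  have hdl : A.det = ∏ i, l i := by simpa using hH.det_eq_prod_eigenvalues
  have hl : ∀ i, l i ≠ 0 := by
    intro i hi
    apply hdet.ne_zero
    rw [hdl]
    exact Finset.prod_eq_zero (Finset.mem_univ i) hi
  set b := hH.eigenvectorBasis with hbdef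
  have hAb : ∀ j, A.toEuclideanLin (b j) = l j • b j := by
    intro j
    have := hH.mulVec_eigenvectorBasis j
    rw [Matrix.toLpLin_apply, this]
    rfl
  have hAb' : ∀ j, A⁻¹.toEuclideanLin (b j) = (l j)⁻¹ • b j := by
    intro j
    have h1 : A⁻¹.toEuclideanLin (A.toEuclideanLin (b j)) = b j := by
      rw [Matrix.toLpLin_apply, Matrix.toLpLin_apply]
      simp [Matrix.mulVec_mulVec, Matrix.nonsing_inv_mul _ hdet]
    rw [hAb, map_smul] at h1
    conv_rhs => rw [← h1]
    rw [smul_smul, inv_mul_cancel₀ (hl j), one_smul]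
  have hsgn : (matSgn A : ℂ) =
      ∑ i, (((if 0 < l i then 1 else 0) - (if l i < 0 then 1 else 0)) : ℂ) := by
    rw [matSgn, dif_pos hH, Finset.sum_sub_distrib, Finset.sum_boole, Finset.sum_boole]
    push_cast
    congr!
  have cq : ∀ B : Matrix (Fin n) (Fin n) ℝ, Continuous (quadForm B) := by
    intro B
    unfold quadForm
    fun_prop
  have hFT := FT_integrable h
  refine ⟨?_, ?_, ?_⟩
  · have := cq A
    refine hFT.bdd_mul (c := 1) (Continuous.aestronglyMeasurable (by fun_prop)) ?_
    refine ae_of_all _ fun x => ?_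
    rw [Complex.norm_exp]
    simp
  · have := cq A⁻¹
    refine h.integrable.bdd_mul (c := 1) (Continuous.aestronglyMeasurable (by fun_prop)) ?_
    refine ae_of_all _ fun x => ?_
    have e : -(Complex.I * quadForm A⁻¹ x / (4 * σ)) =
        ((-(quadForm A⁻¹ x / (4 * σ)) : ℝ) : ℂ) * Complex.I := by push_cast; ring
    rw [e, Complex.norm_exp_ofReal_mul_I]
  · let e := b.repr.symm
    have hm := e.measurePreserving
    have he := e.toHomeomorph.measurableEmbedding
    have hFc : FT (fun y => h (e y)) = fun x => FT (fun y => h y) (e x) := by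
      ext x
      exact FT_comp e (fun y => h y) x
    have key := diag hl hσ (fun y => h (e y)) ((hm.integrable_comp_emb he).2 h.integrable)
      (by rw [hFc]; exact (hm.integrable_comp_emb he).2 hFT)
    rw [hFc] at key
    rw [hsgn, hdl, 
      ← hm.integral_comp he
        (fun x => Complex.exp (Complex.I * σ * quadForm A x) * FT (fun y => h y) x),
      ← hm.integral_comp he
        (fun ξ => Complex.exp (-(Complex.I * quadForm A⁻¹ ξ / (4 * σ))) * h ξ)]
    have q1 : ∀ v, quadForm A (e v) = _ := quadForm_basis A b l hAb
    have q2 : ∀ v, quadForm A⁻¹ (e v) = _ := quadForm_basis A⁻¹ b _ hAb'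
    simp_rw [q1, q2]
    exact key
end

section
/- Let n ≥ 1, let 0 ≤ m ≤ n, and let ξ ∈ ℝⁿ. Then lim_{R→∞} ∫_{[−R,R]^n} exp( i( Σ_{j=1}^m x_j² − Σ_{j=m+1}^n x_j² − ⟨x,ξ⟩ ) ) dx = π^{n/2} e^{iπ(2m−n)/4} exp( −(i/4)( Σ_{j=1}^m ξ_j² − Σ_{j=m+1}^n ξ_j² ) ). -/
open MeasureTheory Filter

lemma fr_norm_exp (b : ℂ) (hb : 0 ≤ b.re) (x : ℝ) : ‖Complex.exp (-b * (x:ℂ)^2)‖ ≤ 1 := by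
  rw [Complex.norm_exp]
  apply Real.exp_le_one_iff.2
  have : (-b * (x:ℂ)^2).re = -(b.re * x^2) := by
    rw [← Complex.ofReal_pow, Complex.re_mul_ofReal]; simp
  rw [this]
  have := mul_nonneg hb (sq_nonneg x)
  linarith

lemma fr_cont (b : ℂ) : Continuous (fun x : ℝ => Complex.exp (-b * (x:ℂ)^2)) := by fun_prop

lemma fr_tail (b : ℂ) (hb : 0 ≤ b.re) (hb1 : 1 ≤ ‖b‖) (R S : ℝ) (hR : 0 < R) (hRS : R ≤ S) :
    ‖∫ x in R..S, Complex.exp (-b * (x:ℂ)^2)‖ ≤ 1 / R := by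
  have hb0 : b ≠ 0 := by rintro rfl; simp at hb1; linarith
  have hS : 0 < S := hR.trans_le hRS
  have hpos : ∀ x ∈ Set.uIcc R S, 0 < x := by
    intro x hx; rw [Set.uIcc_of_le hRS] at hx; exact hR.trans_le hx.1
  set u : ℝ → ℂ := fun x => -Complex.exp (-b * (x:ℂ)^2) / (2 * b * x) with hu
  have hu_norm : ∀ x : ℝ, 0 < x → ‖u x‖ ≤ 1 / (2 * x) := by
    intro x hx
    simp only [hu, norm_div, norm_neg, norm_mul, Complex.norm_real, Complex.norm_ofNat,
      Real.norm_eq_abs, abs_of_pos hx]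
    apply div_le_div₀ zero_le_one (fr_norm_exp b hb x) (by positivity)
    nlinarith
  have hd : ∀ x ∈ Set.uIcc R S, HasDerivAt u
      (Complex.exp (-b * (x:ℂ)^2) + Complex.exp (-b * (x:ℂ)^2) / (2 * b * (x:ℂ)^2)) x := by
    intro x hx
    have hx0 : (x:ℂ) ≠ 0 := by exact_mod_cast (hpos x hx).ne'
    have h1 : HasDerivAt (fun z : ℂ => -Complex.exp (-b * z^2) / (2 * b * z))
      (Complex.exp (-b * (x:ℂ)^2) + Complex.exp (-b * (x:ℂ)^2) / (2 * b * (x:ℂ)^2)) (x:ℂ) := by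
      have := ((((hasDerivAt_id (x:ℂ)).pow 2).const_mul (-b)).cexp.neg).div
        ((hasDerivAt_id (x:ℂ)).const_mul (2*b)) (by simp [hb0, hx0])
      refine this.congr_deriv ?_
      simp
      field_simp
    exact h1.comp_ofReal
  have hc2 : ContinuousOn (fun x : ℝ => Complex.exp (-b * (x:ℂ)^2) / (2 * b * (x:ℂ)^2))
      (Set.uIcc R S) := by
    apply ContinuousOn.div (by fun_prop) (by fun_prop)
    intro x hx
    have hx0 : (x:ℂ) ≠ 0 := by exact_mod_cast (hpos x hx).ne'
    simp [hb0, hx0]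
  have hi1 : IntervalIntegrable (fun x : ℝ => Complex.exp (-b * (x:ℂ)^2)) volume R S :=
    (fr_cont b).intervalIntegrable _ _
  have hi2 := hc2.intervalIntegrable (μ := volume)
  have hF := intervalIntegral.integral_eq_sub_of_hasDerivAt hd (hi1.add hi2)
  rw [intervalIntegral.integral_add hi1 hi2] at hF
  have hcg : ContinuousOn (fun x : ℝ => 1 / (2 * x^2)) (Set.uIcc R S) := by
    apply ContinuousOn.div (by fun_prop) (by fun_prop)
    intro x hx
    have := hpos x hx
    positivity
  have hG := intervalIntegral.integral_eq_sub_of_hasDerivAt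
    (f := fun x : ℝ => -1/(2*x)) (f' := fun x : ℝ => 1 / (2 * x^2)) (a := R) (b := S)
    (by
      intro x hx
      have hx0 := (hpos x hx).ne'
      have := (hasDerivAt_const x (-1:ℝ)).div ((hasDerivAt_id x).const_mul 2) (by simpa using hx0)
      refine this.congr_deriv ?_
      simp
      field_simp
      try ring) hcg.intervalIntegrable
  have hB : ‖∫ x in R..S, Complex.exp (-b * (x:ℂ)^2) / (2 * b * (x:ℂ)^2)‖
      ≤ ∫ x in R..S, 1 / (2 * x^2) := by
    apply intervalIntegral.norm_integral_le_of_norm_le hRS _ hcg.intervalIntegrable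
    refine ae_of_all _ fun x hx => ?_
    have hx0 : 0 < x := hR.trans hx.1
    simp only [norm_div, norm_mul, norm_pow, Complex.norm_real, Complex.norm_ofNat,
      Real.norm_eq_abs, abs_of_pos hx0]
    apply div_le_div₀ zero_le_one (fr_norm_exp b hb x) (by positivity)
    nlinarith [sq_nonneg x]
  rw [hG] at hB
  have h3 : (∫ x in R..S, Complex.exp (-b * (x:ℂ)^2)) = u S - u R
      - ∫ x in R..S, Complex.exp (-b * (x:ℂ)^2) / (2 * b * (x:ℂ)^2) := by
    rw [← hF]; ring
  rw [h3]
  refine (norm_sub_le _ _).trans ?_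
  have h4 := norm_sub_le (u S) (u R)
  have h5 := hu_norm S hS
  have h6 := hu_norm R hR
  have e1 : 1 / R = 1/(2*R) + 1/(2*R) := by field_simp; norm_num
  have e2 : -1/(2*S) = -(1/(2*S)) := by ring
  have e3 : -1/(2*R) = -(1/(2*R)) := by ring
  linarith

lemma fr_bound_pos (b : ℂ) (hb : 0 < b.re) (hb1 : 1 ≤ ‖b‖) (R : ℝ) (hR : 0 < R) :
    ‖(Real.pi / b : ℂ) ^ (1/2 : ℂ) / 2 - ∫ x in (0:ℝ)..R, Complex.exp (-b * (x:ℂ)^2)‖ ≤ 1 / R := by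
  have h1 : Tendsto (fun S : ℝ => ∫ x in (0:ℝ)..S, Complex.exp (-b * (x:ℂ)^2)) atTop
      (nhds ((Real.pi / b : ℂ) ^ (1/2 : ℂ) / 2)) := by
    rw [← integral_gaussian_complex_Ioi hb]
    exact intervalIntegral_tendsto_integral_Ioi 0 (integrable_cexp_neg_mul_sq hb).integrableOn
      tendsto_id
  refine le_of_tendsto (h1.sub_const _).norm ?_
  filter_upwards [eventually_ge_atTop R] with S hS
  rw [intervalIntegral.integral_interval_sub_left ((fr_cont b).intervalIntegrable _ _)
    ((fr_cont b).intervalIntegrable _ _)]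
  exact fr_tail b hb.le hb1 R S hR hS

lemma fr_bound (s : ℝ) (hs : s = 1 ∨ s = -1) (R : ℝ) (hR : 0 < R) :
    ‖(Real.pi / (-(Complex.I * s)) : ℂ) ^ (1/2 : ℂ) / 2
      - ∫ x in (0:ℝ)..R, Complex.exp (-(-(Complex.I * s)) * (x:ℂ)^2)‖ ≤ 1 / R := by
  have hs2 : s^2 = 1 := by rcases hs with rfl | rfl <;> norm_num
  have hs0 : s ≠ 0 := by rcases hs with rfl | rfl <;> norm_num
  have hI : Tendsto (fun e : ℝ => ∫ x in (0:ℝ)..R,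
      Complex.exp (-((e:ℂ) - (Complex.I * s)) * (x:ℂ)^2)) (nhdsWithin 0 (Set.Ioi 0))
      (nhds (∫ x in (0:ℝ)..R, Complex.exp (-(-(Complex.I * s)) * (x:ℂ)^2))) := by
    have hc : Continuous (fun e : ℝ => ∫ x in (0:ℝ)..R,
      Complex.exp (-((e:ℂ) - (Complex.I * s)) * (x:ℂ)^2)) := by
      apply intervalIntegral.continuous_parametric_intervalIntegral_of_continuous' 
      fun_prop
    have := (hc.tendsto 0).mono_left (nhdsWithin_le_nhds (s := Set.Ioi 0))
    simpa using this
  have hP : Tendsto (fun e : ℝ => (Real.pi / ((e:ℂ) - Complex.I * s) : ℂ) ^ (1/2 : ℂ) / 2)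
      (nhdsWithin 0 (Set.Ioi 0))
      (nhds ((Real.pi / (-(Complex.I * s)) : ℂ) ^ (1/2 : ℂ) / 2)) := by
    have hc : ContinuousAt
        (fun e : ℝ => (Real.pi / ((e:ℂ) - Complex.I * s) : ℂ) ^ (1/2 : ℂ) / 2) 0 := by
      apply ContinuousAt.div_const
      apply ContinuousAt.cpow
      · apply ContinuousAt.div (by fun_prop) (by fun_prop)
        simp [hs0]
      · fun_prop
      · right
        rcases hs with rfl | rfl <;> simp [Complex.div_im, Real.pi_ne_zero]
    have := hc.tendsto.mono_left (nhdsWithin_le_nhds (s := Set.Ioi 0))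
    simpa using this
  refine le_of_tendsto (hP.sub hI).norm ?_
  filter_upwards [self_mem_nhdsWithin] with e he
  have he' : 0 < e := he
  apply fr_bound_pos _ _ _ R hR
  · simpa using he'
  · have := Complex.abs_im_le_norm ((e:ℂ) - Complex.I * s)
    refine le_trans ?_ this
    rcases hs with rfl | rfl <;> simp

lemma fr_const (s : ℝ) (hs : s = 1 ∨ s = -1) :
    (Real.pi / (-(Complex.I * s)) : ℂ) ^ (1/2 : ℂ)
      = (Real.sqrt Real.pi : ℂ) * Complex.exp (Complex.I * Real.pi * s / 4) := by
  have h0 : (Real.pi / (-(Complex.I * s)) : ℂ) =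
      Complex.exp ((Real.log Real.pi : ℝ) + (Real.pi * s / 2 : ℝ) * Complex.I) := by
    rw [Complex.exp_add, ← Complex.ofReal_exp, Real.exp_log Real.pi_pos]
    rcases hs with rfl | rfl
    · have : ((Real.pi * 1 / 2 : ℝ) : ℂ) * Complex.I = Real.pi / 2 * Complex.I := by
        push_cast; ring
      rw [this, Complex.exp_pi_div_two_mul_I]
      simp [div_eq_mul_inv]
    · have : ((Real.pi * (-1) / 2 : ℝ) : ℂ) * Complex.I = -Real.pi / 2 * Complex.I := by
        push_cast; ring
      rw [this, Complex.exp_neg_pi_div_two_mul_I]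
      simp [div_eq_mul_inv]
  have hsq : (Real.sqrt Real.pi : ℂ) = Complex.exp ((Real.log Real.pi / 2 : ℝ)) := by
    rw [← Complex.ofReal_exp, ← Real.log_sqrt Real.pi_pos.le,
      Real.exp_log (Real.sqrt_pos.2 Real.pi_pos)]
  rw [h0, Complex.cpow_def_of_ne_zero (Complex.exp_ne_zero _), Complex.log_exp, hsq,
    ← Complex.exp_add]
  · congr 1
    push_cast
    ring
  · have := Real.pi_pos
    rcases hs with rfl | rfl <;> simp <;> linarith
  · have := Real.pi_pos
    rcases hs with rfl | rfl <;> simp <;> linarith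

lemma fr_one (s : ℝ) (hs : s = 1 ∨ s = -1) (t : ℝ) :
    Tendsto (fun R : ℝ => ∫ x in Set.Icc (-R) R,
      Complex.exp (Complex.I * ((s * x^2 - x * t : ℝ) : ℂ))) atTop
      (nhds ((Real.sqrt Real.pi : ℂ) * Complex.exp (Complex.I * Real.pi * s / 4)
        * Complex.exp (-(Complex.I / 4) * ((s * t^2 : ℝ) : ℂ)))) := by
  set G : ℝ → ℂ := fun R => ∫ x in (0:ℝ)..R, Complex.exp (-(-(Complex.I * s)) * (x:ℂ)^2) with hG
  have hs2 : s * s = 1 := by rcases hs with rfl | rfl <;> norm_num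
  have hlim : Tendsto G atTop (nhds ((Real.sqrt Real.pi : ℂ)
      * Complex.exp (Complex.I * Real.pi * s / 4) / 2)) := by
    rw [← fr_const s hs, tendsto_iff_norm_sub_tendsto_zero]
    refine squeeze_zero' (Eventually.of_forall fun _ => norm_nonneg _) ?_
      (tendsto_const_nhds.div_atTop tendsto_id : Tendsto (fun R : ℝ => 1 / id R) atTop (nhds 0))
    filter_upwards [eventually_gt_atTop 0] with R hR
    rw [norm_sub_rev]
    exact fr_bound s hs R hR
  have hodd : ∀ R, G (-R) = - G R := by
    intro R
    have := intervalIntegral.integral_comp_neg (a := 0) (b := R)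
      (fun x : ℝ => Complex.exp (-(-(Complex.I * s)) * (x:ℂ)^2))
    simp only [Complex.ofReal_neg, neg_sq, neg_zero] at this
    simp only [hG]
    rw [intervalIntegral.integral_symm, ← this]
  have hl1 : Tendsto (fun R : ℝ => G (R - s * t / 2)) atTop _ :=
    hlim.comp (tendsto_atTop_add_const_right _ (-(s * t / 2)) tendsto_id)
  have hl2 : Tendsto (fun R : ℝ => G (R + s * t / 2)) atTop _ :=
    hlim.comp (tendsto_atTop_add_const_right _ (s * t / 2) tendsto_id)
  have hl := (hl1.add hl2).mul_const (Complex.exp (-(Complex.I / 4) * ((s * t^2 : ℝ) : ℂ)))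
  rw [add_halves] at hl
  refine hl.congr' ?_
  filter_upwards [eventually_ge_atTop 0] with R hR
  rw [integral_Icc_eq_integral_Ioc, ← intervalIntegral.integral_of_le (by linarith)]
  have hpt : ∀ x : ℝ, Complex.exp (Complex.I * ((s * x^2 - x * t : ℝ) : ℂ)) =
      Complex.exp (-(-(Complex.I * s)) * ((x - s * t / 2 : ℝ):ℂ)^2)
        * Complex.exp (-(Complex.I / 4) * ((s * t^2 : ℝ) : ℂ)) := by
    intro x
    rw [← Complex.exp_add]
    congr 1
    have hc : (s:ℂ) * s = 1 := by exact_mod_cast hs2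
    push_cast
    linear_combination (Complex.I * x * t - Complex.I * s * t^2 / 4) * hc
  simp_rw [hpt]
  rw [intervalIntegral.integral_mul_const, intervalIntegral.integral_comp_sub_right
    (fun x : ℝ => Complex.exp (-(-(Complex.I * s)) * (x:ℂ)^2))]
  congr 1
  rw [← intervalIntegral.integral_interval_sub_left (a := 0)
    ((fr_cont _).intervalIntegrable _ _) ((fr_cont _).intervalIntegrable _ _)]
  change _ = G _ - G _
  rw [show -R - s * t / 2 = -(R + s * t / 2) by ring, hodd]
  ring

lemma fr_sum (n m : ℕ) (hm : m ≤ n) :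
    ∑ j : Fin n, (if (j : ℕ) < m then (1:ℝ) else -1) = 2 * m - n := by
  rw [Fin.sum_univ_eq_sum_range (fun j => if j < m then (1:ℝ) else -1)]
  obtain ⟨k, rfl⟩ := Nat.exists_eq_add_of_le hm
  rw [Finset.sum_range_add]
  rw [Finset.sum_congr rfl (g := fun _ => (1:ℝ)) (fun x hx => by simp [Finset.mem_range.1 hx])]
  simp
  ring


/-- **Fresnel integral limit.** For `0 ≤ m ≤ n` and `ξ ∈ ℝⁿ`,
`lim_{R→∞} ∫_{[−R,R]^n} exp(i(Σ_{j≤m} x_j² − Σ_{j>m} x_j² − ⟨x,ξ⟩)) dx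
  = π^{n/2} e^{iπ(2m−n)/4} exp(−(i/4)(Σ_{j≤m} ξ_j² − Σ_{j>m} ξ_j²))`. -/
theorem stmt6 (n : ℕ) (hn : 1 ≤ n) (m : ℕ) (hm : m ≤ n) (ξ : Fin n → ℝ) :
    Tendsto (fun R : ℝ =>
        ∫ x in Set.pi Set.univ (fun _ : Fin n => Set.Icc (-R) R),
          Complex.exp (Complex.I *
            (((∑ j : Fin n, (if (j : ℕ) < m then (1:ℝ) else -1) * (x j) ^ 2)
                - ∑ j : Fin n, x j * ξ j : ℝ) : ℂ)))
      atTop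
      (nhds (((Real.pi ^ ((n : ℝ) / 2) : ℝ) : ℂ)
        * Complex.exp (Complex.I * Real.pi * (2 * (m : ℝ) - (n : ℝ)) / 4)
        * Complex.exp (-(Complex.I / 4)
            * ((∑ j : Fin n, (if (j : ℕ) < m then (1:ℝ) else -1) * (ξ j) ^ 2 : ℝ) : ℂ)))) := by
  set σ : Fin n → ℝ := fun j => if (j : ℕ) < m then (1:ℝ) else -1 with hσ
  have hs : ∀ j, σ j = 1 ∨ σ j = -1 := by
    intro j
    simp only [hσ]
    split_ifs <;> simp
  have hl := tendsto_finsetProd Finset.univ (fun j _ => fr_one (σ j) (hs j) (ξ j))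
  have hsum : ∑ j, σ j = 2 * m - n := fr_sum n m hm
  have hconst : (((Real.pi ^ ((n : ℝ) / 2) : ℝ) : ℂ)
        * Complex.exp (Complex.I * Real.pi * (2 * (m : ℝ) - (n : ℝ)) / 4)
        * Complex.exp (-(Complex.I / 4) * ((∑ j : Fin n, σ j * (ξ j) ^ 2 : ℝ) : ℂ)))
      = ∏ j, ((Real.sqrt Real.pi : ℂ) * Complex.exp (Complex.I * Real.pi * σ j / 4)
        * Complex.exp (-(Complex.I / 4) * ((σ j * (ξ j)^2 : ℝ) : ℂ))) := by
    rw [Finset.prod_mul_distrib, Finset.prod_mul_distrib, ← Complex.exp_sum, ← Complex.exp_sum,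
      Finset.prod_const, Finset.card_univ, Fintype.card_fin, ← Finset.sum_div, ← Finset.mul_sum,
      ← Finset.mul_sum, ← Complex.ofReal_sum, ← Complex.ofReal_sum, hsum]
    congr 2
    · rw [← Complex.ofReal_pow, Real.sqrt_eq_rpow, ← Real.rpow_mul_natCast Real.pi_pos.le]
      congr 2
      ring
    · push_cast
      rfl
  rw [hconst]
  refine hl.congr fun R => ?_
  rw [volume_pi, Measure.restrict_pi_pi, ← integral_fintype_prod_eq_prod]
  refine integral_congr_ae (ae_of_all _ fun x => ?_)
  simp only
  rw [← Complex.exp_sum, ← Finset.mul_sum, ← Complex.ofReal_sum, Finset.sum_sub_distrib]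
end
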